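/- arXiv:1504.04419 — 3 statements merged into one kernel-verified Lean document; each statement's English description precedes it below -/
import Mathlib

section
/- Let 𝒳, 𝒜, 𝒴 be finite alphabets and W(·|·,·) a strictly positive stochastic matrix from 𝒳×𝒜 to 𝒴. Let X, A, Ã be independent random vectors taking values in 𝒳ⁿ, 𝒜ⁿ, 𝒜ⁿ respectively, and let Y and Ỹ be outputs of the blocklength-n memoryless channel P_{Y|X,A}(y|x,a) = ∏_{j=1}^n W(y_j|x_j,a_j) with inputs (X,A) and (X,Ã) respectively. Then D(P_Y ‖ P_Ỹ) + D(P_Ỹ ‖ P_Y) ≤ 2c·n·d̄(P_Y, P_Ỹ), where c = max over x ∈ 𝒳, a ∈ 𝒜, y, y' ∈ 𝒴 of log( W(y|x,a) / W(y'|x,a) ). -/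
open scoped BigOperators

noncomputable section

/-- `p` is a probability distribution on the finite set `α`. -/
def IsDist {α : Type*} [Fintype α] (p : α → ℝ) : Prop :=
  (∀ a, 0 ≤ p a) ∧ ∑ a, p a = 1

/-- Shannon entropy `H(p) = −∑ p log p` (natural logarithm). -/
def Hent {α : Type*} [Fintype α] (p : α → ℝ) : ℝ :=
  ∑ a, Real.negMulLog (p a)

/-- Ornstein's `d̄`-distance between distributions on `αⁿ`: `(1/n)` times the minimal expected
Hamming distance over all couplings. -/
def dbar {α : Type*} [Fintype α] [DecidableEq α] (n : ℕ) (p q : (Fin n → α) → ℝ) : ℝ :=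
  sInf { r | ∃ γ : (Fin n → α) × (Fin n → α) → ℝ,
    (∀ z, 0 ≤ γ z) ∧ (∀ x, ∑ y, γ (x, y) = p x) ∧ (∀ y, ∑ x, γ (x, y) = q y) ∧
    r = (1 / (n : ℝ)) * ∑ z : (Fin n → α) × (Fin n → α), γ z * (hammingDist z.1 z.2 : ℝ) }

/-- The output distribution of the blocklength-`n` memoryless two-input channel `W` when the
independent inputs have distributions `pX` and `pA`. -/
def outDist {𝒳 𝒜 𝒴 : Type*} [Fintype 𝒳] [Fintype 𝒜] [Fintype 𝒴] {n : ℕ}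
    (W : 𝒳 → 𝒜 → 𝒴 → ℝ) (pX : (Fin n → 𝒳) → ℝ) (pA : (Fin n → 𝒜) → ℝ) :
    (Fin n → 𝒴) → ℝ :=
  fun y => ∑ x : Fin n → 𝒳, ∑ a : Fin n → 𝒜, pX x * pA a * ∏ j, W (x j) (a j) (y j)

/-- The conditional output distribution given the first input `x`, when the second (independent)
input has distribution `pA`. -/
def condOut {𝒳 𝒜 𝒴 : Type*} [Fintype 𝒜] [Fintype 𝒴] {n : ℕ}
    (W : 𝒳 → 𝒜 → 𝒴 → ℝ) (pA : (Fin n → 𝒜) → ℝ) (x : Fin n → 𝒳) :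
    (Fin n → 𝒴) → ℝ :=
  fun y => ∑ a : Fin n → 𝒜, pA a * ∏ j, W (x j) (a j) (y j)

/-- Kullback–Leibler divergence `D(p‖q) = ∑ p log (p/q)` between distributions on a finite set. -/
def Dkl {α : Type*} [Fintype α] (p q : α → ℝ) : ℝ :=
  ∑ a, p a * Real.log (p a / q a)

lemma chan_bound {𝒴 : Type*} [DecidableEq 𝒴] {n : ℕ} (w : Fin n → 𝒴 → ℝ) (c : ℝ)
    (hw : ∀ j y, 0 < w j y) (hc : ∀ j y y', Real.log (w j y / w j y') ≤ c)
    (y y' : Fin n → 𝒴) :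
    ∏ j, w j (y j) ≤ Real.exp (c * hammingDist y y') * ∏ j, w j (y' j) := by
  have h1 : Real.exp (c * hammingDist y y') = ∏ j, (if y j ≠ y' j then Real.exp c else 1) := by
    rw [Finset.prod_ite]
    simp only [Finset.prod_const, one_pow, mul_one]
    rw [mul_comm, Real.exp_nat_mul]
    rfl
  rw [h1, ← Finset.prod_mul_distrib]
  refine Finset.prod_le_prod (fun j _ => (hw j _).le) (fun j _ => ?_)
  split_ifs with h
  · have h2 := hc j (y j) (y' j)
    rw [Real.log_le_iff_le_exp (div_pos (hw _ _) (hw _ _)), div_le_iff₀ (hw _ _)] at h2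
    exact h2
  · push Not at h
    simp [h]

lemma outDist_bound {𝒳 𝒜 𝒴 : Type*} [Fintype 𝒳] [Fintype 𝒜] [Fintype 𝒴] [DecidableEq 𝒴]
    (W : 𝒳 → 𝒜 → 𝒴 → ℝ) (hW : ∀ x a y, 0 < W x a y) {n : ℕ} (c : ℝ)
    (hc : ∀ x a y y', Real.log (W x a y / W x a y') ≤ c)
    (pX : (Fin n → 𝒳) → ℝ) (pA : (Fin n → 𝒜) → ℝ) (hpX : IsDist pX) (hpA : IsDist pA)
    (y y' : Fin n → 𝒴) :
    outDist W pX pA y ≤ Real.exp (c * hammingDist y y') * outDist W pX pA y' := by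
  unfold outDist
  rw [Finset.mul_sum]
  refine Finset.sum_le_sum fun x _ => ?_
  rw [Finset.mul_sum]
  refine Finset.sum_le_sum fun a _ => ?_
  have := chan_bound (fun j => W (x j) (a j)) c (fun j y => hW _ _ _)
    (fun j y y' => hc _ _ _ _) y y'
  calc _ ≤ pX x * pA a * _ := mul_le_mul_of_nonneg_left this (mul_nonneg (hpX.1 x) (hpA.1 a))
    _ = _ := by ring

lemma outDist_sum {𝒳 𝒜 𝒴 : Type*} [Fintype 𝒳] [Fintype 𝒜] [Fintype 𝒴]
    (W : 𝒳 → 𝒜 → 𝒴 → ℝ) (hW : ∀ x a, ∑ y, W x a y = 1) {n : ℕ}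
    (pX : (Fin n → 𝒳) → ℝ) (pA : (Fin n → 𝒜) → ℝ) (hpX : IsDist pX) (hpA : IsDist pA) :
    ∑ y, outDist W pX pA y = 1 := by
  classical
  unfold outDist
  rw [Finset.sum_comm]
  have : ∀ x : Fin n → 𝒳, ∑ y : Fin n → 𝒴, ∑ a : Fin n → 𝒜,
      pX x * pA a * ∏ j, W (x j) (a j) (y j) = pX x := by
    intro x
    rw [Finset.sum_comm]
    have h2 : ∀ a : Fin n → 𝒜, ∑ y : Fin n → 𝒴, pX x * pA a * ∏ j, W (x j) (a j) (y j)
        = pX x * pA a := by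
      intro a
      rw [← Finset.mul_sum, ← Fintype.prod_sum (fun j => W (x j) (a j))]
      simp [hW]
    simp only [h2]
    rw [← Finset.mul_sum, hpA.2, mul_one]
  simp only [this]
  exact hpX.2

lemma outDist_pos {𝒳 𝒜 𝒴 : Type*} [Fintype 𝒳] [Fintype 𝒜] [Fintype 𝒴]
    (W : 𝒳 → 𝒜 → 𝒴 → ℝ) (hW : ∀ x a y, 0 < W x a y) {n : ℕ}
    (pX : (Fin n → 𝒳) → ℝ) (pA : (Fin n → 𝒜) → ℝ) (hpX : IsDist pX) (hpA : IsDist pA)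
    (y : Fin n → 𝒴) : 0 < outDist W pX pA y := by
  have ex : ∀ {α : Type _} [Fintype α] (p : α → ℝ), IsDist p → ∃ a, 0 < p a := by
    intro α _ p hp
    by_contra! h
    have := Finset.sum_nonpos (fun a (_ : a ∈ Finset.univ) => h a)
    rw [hp.2] at this
    linarith
  have ex' : ∀ {α : Type _} [Fintype α] (p : α → ℝ), IsDist p → ∃ a, 0 < p a := by
    intro α _ p hp
    by_contra! h
    have := Finset.sum_nonpos (fun a (_ : a ∈ Finset.univ) => h a)
    rw [hp.2] at this
    linarith
  obtain ⟨x, hx⟩ := ex pX hpX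
  obtain ⟨a, ha⟩ := ex' pA hpA
  have hP : ∀ (x : Fin n → 𝒳) (a : Fin n → 𝒜), 0 < ∏ j, W (x j) (a j) (y j) :=
    fun x a => Finset.prod_pos fun j _ => hW _ _ _
  have hnn : ∀ (x : Fin n → 𝒳) (a : Fin n → 𝒜),
      0 ≤ pX x * pA a * ∏ j, W (x j) (a j) (y j) :=
    fun x a => mul_nonneg (mul_nonneg (hpX.1 x) (hpA.1 a)) (hP x a).le
  refine Finset.sum_pos' (fun x _ => Finset.sum_nonneg fun a _ => hnn x a)
    ⟨x, Finset.mem_univ _, Finset.sum_pos' (fun a _ => hnn x a) ⟨a, Finset.mem_univ _, ?_⟩⟩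
  exact mul_pos (mul_pos hx ha) (hP x a)

/-- In the setting of a strictly positive memoryless two-input channel with
independent inputs `X, A, Ã` and outputs `Y, Ỹ`,
`D(P_Y‖P_Ỹ) + D(P_Ỹ‖P_Y) ≤ 2 c n d̄(P_Y, P_Ỹ)` with
`c = max_{x,a,y,y'} log (W(y|x,a)/W(y'|x,a))`. -/
theorem stmt15 {𝒳 𝒜 𝒴 : Type*} [Fintype 𝒳] [Fintype 𝒜] [Fintype 𝒴]
    [Nonempty 𝒳] [Nonempty 𝒜] [Nonempty 𝒴] [DecidableEq 𝒴]
    (W : 𝒳 → 𝒜 → 𝒴 → ℝ) (hW : ∀ x a, (∀ y, 0 < W x a y) ∧ ∑ y, W x a y = 1)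
    {n : ℕ} (hn : 1 ≤ n)
    (pX : (Fin n → 𝒳) → ℝ) (pA pA' : (Fin n → 𝒜) → ℝ)
    (hpX : IsDist pX) (hpA : IsDist pA) (hpA' : IsDist pA') :
    Dkl (outDist W pX pA) (outDist W pX pA') + Dkl (outDist W pX pA') (outDist W pX pA) ≤
      2 * (⨆ x, ⨆ a, ⨆ y, ⨆ y', Real.log (W x a y / W x a y')) * n *
        dbar n (outDist W pX pA) (outDist W pX pA') := by
  set c := ⨆ x, ⨆ a, ⨆ y, ⨆ y', Real.log (W x a y / W x a y') with hcdef
  have hc : ∀ x a y y', Real.log (W x a y / W x a y') ≤ c := by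
    intro x a y y'
    calc _ ≤ ⨆ y', Real.log (W x a y / W x a y') :=
          le_ciSup (f := fun y' => Real.log (W x a y / W x a y')) (Set.finite_range _).bddAbove y'
      _ ≤ ⨆ y, ⨆ y', Real.log (W x a y / W x a y') :=
          le_ciSup (f := fun y => ⨆ y', Real.log (W x a y / W x a y'))
            (Set.finite_range _).bddAbove y
      _ ≤ ⨆ a, ⨆ y, ⨆ y', Real.log (W x a y / W x a y') :=
          le_ciSup (f := fun a => ⨆ y, ⨆ y', Real.log (W x a y / W x a y'))
            (Set.finite_range _).bddAbove a
      _ ≤ c := le_ciSup (f := fun x => ⨆ a, ⨆ y, ⨆ y', Real.log (W x a y / W x a y'))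
            (Set.finite_range _).bddAbove x
  have hWp : ∀ x a y, 0 < W x a y := fun x a y => (hW x a).1 y
  have hc0 : 0 ≤ c := by
    obtain ⟨x⟩ := ‹Nonempty 𝒳›
    obtain ⟨a⟩ := ‹Nonempty 𝒜›
    obtain ⟨y⟩ := ‹Nonempty 𝒴›
    have := hc x a y y
    rwa [div_self (hWp x a y).ne', Real.log_one] at this
  have hlog : ∀ p : (Fin n → 𝒜) → ℝ, IsDist p → ∀ y y' : Fin n → 𝒴,
      Real.log (outDist W pX p y) - Real.log (outDist W pX p y') ≤ c * hammingDist y y' := by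
    intro p hp y y'
    have h1 := outDist_bound W hWp c hc pX p hpX hp y y'
    have h2 := Real.log_le_log (outDist_pos W hWp pX p hpX hp y) h1
    rw [Real.log_mul (Real.exp_pos _).ne' (outDist_pos W hWp pX p hpX hp y').ne',
      Real.log_exp] at h2
    linarith
  have hsP := outDist_sum W (fun x a => (hW x a).2) pX pA hpX hpA
  have hsQ := outDist_sum W (fun x a => (hW x a).2) pX pA' hpX hpA'
  have hP := outDist_pos W hWp pX pA hpX hpA
  have hQ := outDist_pos W hWp pX pA' hpX hpA'
  have hlP := hlog pA hpA
  have hlQ := hlog pA' hpA'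
  generalize outDist W pX pA = P at *
  generalize outDist W pX pA' = Q at *
  have hn0 : (0 : ℝ) < n := by exact_mod_cast hn
  set S := { r : ℝ | ∃ γ : (Fin n → 𝒴) × (Fin n → 𝒴) → ℝ,
    (∀ z, 0 ≤ γ z) ∧ (∀ x, ∑ y, γ (x, y) = P x) ∧ (∀ y, ∑ x, γ (x, y) = Q y) ∧
    r = (1 / (n : ℝ)) * ∑ z : (Fin n → 𝒴) × (Fin n → 𝒴), γ z * (hammingDist z.1 z.2 : ℝ) }
    with hS
  have hd : dbar n P Q = sInf S := rfl
  have hne : S.Nonempty := by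
    refine ⟨_, fun z => P z.1 * Q z.2, fun z => (mul_pos (hP _) (hQ _)).le, ?_, ?_, rfl⟩
    · intro x
      simp [← Finset.mul_sum, hsQ]
    · intro y
      simp [← Finset.sum_mul, hsP]
  have key : ∀ r ∈ S, Dkl P Q + Dkl Q P ≤ 2 * c * n * r := by
    rintro r ⟨γ, hγ, h1, h2, rfl⟩
    have e1 : Dkl P Q + Dkl Q P = ∑ z : (Fin n → 𝒴) × (Fin n → 𝒴),
        γ z * ((Real.log (P z.1) - Real.log (P z.2)) + (Real.log (Q z.2) - Real.log (Q z.1))) := by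
      have a1 : Dkl P Q = ∑ z : (Fin n → 𝒴) × (Fin n → 𝒴),
          γ z * (Real.log (P z.1) - Real.log (Q z.1)) := by
        rw [Fintype.sum_prod_type]
        refine Finset.sum_congr rfl fun x _ => ?_
        dsimp only
        rw [← Finset.sum_mul, h1, Real.log_div (hP x).ne' (hQ x).ne']
      have a2 : Dkl Q P = ∑ z : (Fin n → 𝒴) × (Fin n → 𝒴),
          γ z * (Real.log (Q z.2) - Real.log (P z.2)) := by
        rw [Fintype.sum_prod_type_right]
        refine Finset.sum_congr rfl fun x _ => ?_
        dsimp only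
        rw [← Finset.sum_mul, h2, Real.log_div (hQ x).ne' (hP x).ne']
      rw [a1, a2, ← Finset.sum_add_distrib]
      exact Finset.sum_congr rfl fun z _ => by ring
    have e2 : 2 * c * n * ((1 / (n : ℝ)) * ∑ z : (Fin n → 𝒴) × (Fin n → 𝒴),
        γ z * (hammingDist z.1 z.2 : ℝ)) = ∑ z : (Fin n → 𝒴) × (Fin n → 𝒴),
        γ z * (2 * c * (hammingDist z.1 z.2 : ℝ)) := by
      rw [← mul_assoc, mul_assoc (2 * c), mul_one_div_cancel hn0.ne', mul_one, Finset.mul_sum]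
      exact Finset.sum_congr rfl fun z _ => by ring
    rw [e1, e2]
    refine Finset.sum_le_sum fun z _ => mul_le_mul_of_nonneg_left ?_ (hγ z)
    have b1 := hlP z.1 z.2
    have b2 := hlQ z.2 z.1
    rw [hammingDist_comm] at b2
    linarith
  rw [hd]
  rcases hc0.eq_or_lt with h0 | h0
  · obtain ⟨r, hr⟩ := hne
    have := key r hr
    rw [← h0] at this ⊢
    simpa using this
  · have hpos : 0 < 2 * c * n := by positivity
    rw [← div_le_iff₀' hpos]
    refine le_csInf hne fun r hr => ?_
    rw [div_le_iff₀' hpos]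
    exact key r hr
end
end

section
/- Let 𝒳, 𝒜, 𝒴 be finite alphabets and W(·|·,·) a strictly positive stochastic matrix from 𝒳×𝒜 to 𝒴. Let X, A, Ã be independent random vectors taking values in 𝒳ⁿ, 𝒜ⁿ, 𝒜ⁿ respectively, and let Y and Ỹ be outputs of the blocklength-n memoryless channel P_{Y|X,A}(y|x,a) = ∏_{j=1}^n W(y_j|x_j,a_j) with inputs (X,A) and (X,Ã) respectively. Then |I(X;Y) − I(X;Ỹ)| ≤ 2c·n·Σ_{x ∈ 𝒳ⁿ} P_X(x) · d̄(P_{Y|X=x}, P_{Ỹ|X=x}), where c = max over x ∈ 𝒳, a ∈ 𝒜, y, y' ∈ 𝒴 of log( W(y|x,a) / W(y'|x,a) ). -/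
open scoped BigOperators

noncomputable section

/-- Positive distributions whose logarithm is `c`-Lipschitz for the Hamming distance. -/
def GoodDist {α : Type*} [Fintype α] [DecidableEq α] {n : ℕ} (c : ℝ) (p : (Fin n → α) → ℝ) :
    Prop :=
  (∀ y, 0 < p y) ∧ ∑ y, p y = 1 ∧ ∀ y y', p y ≤ Real.exp (c * (hammingDist y y' : ℝ)) * p y'

theorem GoodDist.log_lip {α : Type*} [Fintype α] [DecidableEq α] {n : ℕ} {c : ℝ}
    {p : (Fin n → α) → ℝ} (h : GoodDist c p) (y y' : Fin n → α) :
    Real.log (p y) - Real.log (p y') ≤ c * (hammingDist y y' : ℝ) := by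
  have h1 := Real.log_le_log (h.1 y) (h.2.2 y y')
  rw [Real.log_mul (Real.exp_pos _).ne' (h.1 y').ne', Real.log_exp] at h1
  linarith

theorem GoodDist.mix {α ι : Type*} [Fintype α] [DecidableEq α] [Fintype ι] {n : ℕ} {c : ℝ}
    {w : ι → ℝ} (hw : IsDist w) {p : ι → (Fin n → α) → ℝ} (h : ∀ i, GoodDist c (p i)) :
    GoodDist c (fun y => ∑ i, w i * p i y) := by
  refine ⟨fun y => ?_, ?_, fun y y' => ?_⟩
  · have hne : ∃ i, 0 < w i := by
      by_contra! hcon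
      have := Finset.sum_nonpos (fun i (_ : i ∈ Finset.univ) => hcon i)
      rw [hw.2] at this
      linarith
    obtain ⟨i, hi⟩ := hne
    exact Finset.sum_pos' (fun j _ => mul_nonneg (hw.1 j) ((h j).1 y).le)
      ⟨i, Finset.mem_univ _, mul_pos hi ((h i).1 y)⟩
  · rw [Finset.sum_comm]
    simp_rw [← Finset.mul_sum, (h _).2.1, mul_one]
    exact hw.2
  · simp only
    rw [Finset.mul_sum]
    refine Finset.sum_le_sum fun i _ => ?_
    have := mul_le_mul_of_nonneg_left ((h i).2.2 y y') (hw.1 i)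
    linarith

theorem GoodDist.prod {α : Type*} [Fintype α] [DecidableEq α] {n : ℕ} {c : ℝ}
    {w : Fin n → α → ℝ} (hpos : ∀ j y, 0 < w j y) (hsum : ∀ j, ∑ y, w j y = 1)
    (hc : ∀ j y y', w j y ≤ Real.exp c * w j y') :
    GoodDist c (fun y => ∏ j, w j (y j)) := by
  refine ⟨fun y => Finset.prod_pos fun j _ => hpos j _, ?_, fun y y' => ?_⟩
  · have := Finset.prod_univ_sum (fun _ : Fin n => (Finset.univ : Finset α)) w
    simp only [hsum, Finset.prod_const_one, Fintype.piFinset_univ] at this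
    exact this.symm
  · have h1 : Real.exp (c * (hammingDist y y' : ℝ))
        = ∏ j, (if y j ≠ y' j then Real.exp c else 1) := by
      rw [Finset.prod_ite, Finset.prod_const_one, mul_one, Finset.prod_const, mul_comm,
        Real.exp_nat_mul]
      rfl
    simp only
    rw [h1, ← Finset.prod_mul_distrib]
    refine Finset.prod_le_prod (fun j _ => (hpos j _).le) fun j _ => ?_
    split_ifs with hj
    · exact hc j _ _
    · push Not at hj
      rw [hj, one_mul]

/-- Easy half of Kantorovich duality for `dbar`. -/
theorem dbar_dual {α : Type*} [Fintype α] [DecidableEq α] {n : ℕ} (hn : 1 ≤ n) {c : ℝ}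
    (hc : 0 ≤ c) {p q : (Fin n → α) → ℝ} (hp : IsDist p) (hq : IsDist q)
    (f : (Fin n → α) → ℝ) (hf : ∀ y y', f y - f y' ≤ c * (hammingDist y y' : ℝ)) :
    ∑ y, (p y - q y) * f y ≤ c * n * dbar n p q := by
  have hn0 : (0 : ℝ) < n := by exact_mod_cast hn
  have key : ∀ r ∈ { r | ∃ γ : (Fin n → α) × (Fin n → α) → ℝ,
    (∀ z, 0 ≤ γ z) ∧ (∀ x, ∑ y, γ (x, y) = p x) ∧ (∀ y, ∑ x, γ (x, y) = q y) ∧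
    r = (1 / (n : ℝ)) * ∑ z : (Fin n → α) × (Fin n → α), γ z * (hammingDist z.1 z.2 : ℝ) },
      ∑ y, (p y - q y) * f y ≤ c * n * r := by
    rintro r ⟨γ, h0, h1, h2, rfl⟩
    have e1 : ∑ y, (p y - q y) * f y = ∑ z : (Fin n → α) × (Fin n → α),
        γ z * (f z.1 - f z.2) := by
      simp_rw [sub_mul, mul_sub, Finset.sum_sub_distrib]
      congr 1
      · rw [Fintype.sum_prod_type]
        refine Finset.sum_congr rfl fun x _ => ?_
        simp only
        rw [← Finset.sum_mul, h1]
      · rw [Fintype.sum_prod_type_right]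
        refine Finset.sum_congr rfl fun x _ => ?_
        simp only
        rw [← Finset.sum_mul, h2]
    have e2 : c * n * ((1 / (n : ℝ)) * ∑ z : (Fin n → α) × (Fin n → α),
        γ z * (hammingDist z.1 z.2 : ℝ)) = ∑ z : (Fin n → α) × (Fin n → α),
        γ z * (c * (hammingDist z.1 z.2 : ℝ)) := by
      have : c * n * (1 / (n : ℝ)) = c := by field_simp
      rw [← mul_assoc, this, Finset.mul_sum]
      exact Finset.sum_congr rfl fun z _ => by ring
    rw [e1, e2]
    exact Finset.sum_le_sum fun z _ => mul_le_mul_of_nonneg_left (hf _ _) (h0 z)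
  have hne : { r | ∃ γ : (Fin n → α) × (Fin n → α) → ℝ,
    (∀ z, 0 ≤ γ z) ∧ (∀ x, ∑ y, γ (x, y) = p x) ∧ (∀ y, ∑ x, γ (x, y) = q y) ∧
    r = (1 / (n : ℝ)) * ∑ z : (Fin n → α) × (Fin n → α),
      γ z * (hammingDist z.1 z.2 : ℝ) }.Nonempty := by
    refine ⟨_, fun z => p z.1 * q z.2, fun z => mul_nonneg (hp.1 _) (hq.1 _), fun x => ?_,
      fun y => ?_, rfl⟩
    · simp only
      rw [← Finset.mul_sum, hq.2, mul_one]
    · simp only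
      rw [← Finset.sum_mul, hp.2, one_mul]
  rcases hc.eq_or_lt with rfl | hc
  · obtain ⟨r, hr⟩ := hne
    have := key r hr
    simpa using this
  · have hcn : 0 < c * n := mul_pos hc hn0
    rw [mul_comm (c * n), ← div_le_iff₀ hcn]
    refine le_csInf hne fun r hr => ?_
    rw [div_le_iff₀ hcn, mul_comm r]
    exact key r hr

theorem Hent_gibbs {α : Type*} [Fintype α] {p q : α → ℝ} (hp : ∀ a, 0 < p a)
    (hq : ∀ a, 0 < q a) (hp1 : ∑ a, p a = 1) (hq1 : ∑ a, q a = 1) :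
    Hent p - Hent q ≤ ∑ a, (q a - p a) * Real.log (q a) := by
  have h : ∀ a, Real.negMulLog (p a) - Real.negMulLog (q a)
      ≤ (q a - p a) * Real.log (q a) + (q a - p a) := by
    intro a
    have h1 := Real.log_le_sub_one_of_pos (div_pos (hq a) (hp a))
    rw [Real.log_div (hq a).ne' (hp a).ne'] at h1
    have h2 := mul_le_mul_of_nonneg_left h1 (hp a).le
    have h3 : p a * (q a / p a - 1) = q a - p a := by
      have := (hp a).ne'
      field_simp
    rw [h3] at h2
    simp only [Real.negMulLog]
    linarith
  have hs := Finset.sum_le_sum fun a (_ : a ∈ Finset.univ) => h a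
  rw [Finset.sum_sub_distrib, Finset.sum_add_distrib, Finset.sum_sub_distrib, hp1, hq1] at hs
  simp only [Hent]
  linarith

/-- In the setting of a strictly positive memoryless two-input channel with
independent inputs `X, A, Ã` and outputs `Y, Ỹ`, with mutual information
`I(X;Y) = H(Y) − H(Y|X)` (and `H(Y|X) = ∑_x P_X(x) H(P_{Y|X=x})`),
`|I(X;Y) − I(X;Ỹ)| ≤ 2 c n ∑_x P_X(x) d̄(P_{Y|X=x}, P_{Ỹ|X=x})` with
`c = max_{x,a,y,y'} log (W(y|x,a)/W(y'|x,a))`. -/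
theorem stmt16 {𝒳 𝒜 𝒴 : Type*} [Fintype 𝒳] [Fintype 𝒜] [Fintype 𝒴]
    [Nonempty 𝒳] [Nonempty 𝒜] [Nonempty 𝒴] [DecidableEq 𝒴]
    (W : 𝒳 → 𝒜 → 𝒴 → ℝ) (hW : ∀ x a, (∀ y, 0 < W x a y) ∧ ∑ y, W x a y = 1)
    {n : ℕ} (hn : 1 ≤ n)
    (pX : (Fin n → 𝒳) → ℝ) (pA pA' : (Fin n → 𝒜) → ℝ)
    (hpX : IsDist pX) (hpA : IsDist pA) (hpA' : IsDist pA') :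
    |(Hent (outDist W pX pA) - ∑ x, pX x * Hent (condOut W pA x)) -
        (Hent (outDist W pX pA') - ∑ x, pX x * Hent (condOut W pA' x))| ≤
      2 * (⨆ x, ⨆ a, ⨆ y, ⨆ y', Real.log (W x a y / W x a y')) * n *
        ∑ x, pX x * dbar n (condOut W pA x) (condOut W pA' x) := by
  classical
  set c := ⨆ x, ⨆ a, ⨆ y, ⨆ y', Real.log (W x a y / W x a y') with hcdef
  have hle : ∀ x a y y', Real.log (W x a y / W x a y') ≤ c := by
    intro x a y y'
    refine le_trans ?_ (le_ciSup (Set.finite_range _).bddAbove x)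
    refine le_trans ?_ (le_ciSup (Set.finite_range _).bddAbove a)
    refine le_trans ?_ (le_ciSup (Set.finite_range _).bddAbove y)
    exact le_ciSup (f := fun y' => Real.log (W x a y / W x a y'))
      (Set.finite_range _).bddAbove y'
  have hc : 0 ≤ c := by
    obtain ⟨x⟩ := ‹Nonempty 𝒳›
    obtain ⟨a⟩ := ‹Nonempty 𝒜›
    obtain ⟨y⟩ := ‹Nonempty 𝒴›
    have := hle x a y y
    rwa [div_self ((hW x a).1 y).ne', Real.log_one] at this
  clear_value c
  have hexp : ∀ x a y y', W x a y ≤ Real.exp c * W x a y' := by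
    intro x a y y'
    have h1 := hle x a y y'
    rw [Real.log_le_iff_le_exp (div_pos ((hW x a).1 y) ((hW x a).1 y')),
      div_le_iff₀ ((hW x a).1 y')] at h1
    exact h1
  have gcond : ∀ p : (Fin n → 𝒜) → ℝ, IsDist p → ∀ x, GoodDist c (condOut W p x) := by
    intro p hp x
    exact GoodDist.mix hp (p := fun a y => ∏ j, W (x j) (a j) (y j)) fun a =>
      GoodDist.prod (w := fun j => W (x j) (a j)) (fun j y => (hW _ _).1 y)
        (fun j => (hW _ _).2) (fun j => hexp _ _)
  have eout : ∀ p : (Fin n → 𝒜) → ℝ, outDist W pX p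
      = fun y => ∑ x, pX x * condOut W p x y := by
    intro p
    funext y
    simp only [outDist, condOut, Finset.mul_sum, mul_assoc]
  have gout : ∀ p : (Fin n → 𝒜) → ℝ, IsDist p → GoodDist c (outDist W pX p) := by
    intro p hp
    rw [eout]
    exact GoodDist.mix hpX (gcond p hp)
  have isd : ∀ p : (Fin n → 𝒴) → ℝ, GoodDist c p → IsDist p :=
    fun p hp => ⟨fun a => (hp.1 a).le, hp.2.1⟩
  have dual : ∀ f : (Fin n → 𝒴) → ℝ, (∀ y y', f y - f y' ≤ c * (hammingDist y y' : ℝ)) →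
      ∀ x, ∑ y, (condOut W pA x y - condOut W pA' x y) * f y
        ≤ c * n * dbar n (condOut W pA x) (condOut W pA' x) := fun f hf x =>
    dbar_dual hn hc (isd _ (gcond pA hpA x)) (isd _ (gcond pA' hpA' x)) f hf
  set S := ∑ x, pX x * dbar n (condOut W pA x) (condOut W pA' x) with hS
  have eS : c * n * S = ∑ x, pX x * (c * n * dbar n (condOut W pA x) (condOut W pA' x)) := by
    rw [hS, Finset.mul_sum]
    exact Finset.sum_congr rfl fun x _ => by ring
  have dualout : ∀ f : (Fin n → 𝒴) → ℝ, (∀ y y', f y - f y' ≤ c * (hammingDist y y' : ℝ)) →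
      ∑ y, (outDist W pX pA y - outDist W pX pA' y) * f y ≤ c * n * S := by
    intro f hf
    have e : ∑ y, (outDist W pX pA y - outDist W pX pA' y) * f y
        = ∑ x, pX x * ∑ y, (condOut W pA x y - condOut W pA' x y) * f y := by
      simp_rw [Finset.mul_sum]
      rw [Finset.sum_comm]
      refine Finset.sum_congr rfl fun y _ => ?_
      rw [eout, eout]
      simp only
      rw [← Finset.sum_sub_distrib, Finset.sum_mul]
      exact Finset.sum_congr rfl fun x _ => by ring
    rw [e, eS]
    exact Finset.sum_le_sum fun x _ => mul_le_mul_of_nonneg_left (dual f hf x) (hpX.1 x)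
  have lipneg : ∀ p : (Fin n → 𝒴) → ℝ, GoodDist c p → ∀ y y',
      (- Real.log (p y)) - (- Real.log (p y')) ≤ c * (hammingDist y y' : ℝ) := by
    intro p hp y y'
    have := hp.log_lip y' y
    rw [hammingDist_comm] at this
    linarith
  have gib : ∀ p q : (Fin n → 𝒴) → ℝ, GoodDist c p → GoodDist c q → ∀ D : ℝ,
      (∀ f : (Fin n → 𝒴) → ℝ, (∀ y y', f y - f y' ≤ c * (hammingDist y y' : ℝ)) →
        ∑ y, (p y - q y) * f y ≤ D) → Hent p - Hent q ≤ D ∧ Hent q - Hent p ≤ D := by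
    intro p q hp hq D hD
    constructor
    · refine (Hent_gibbs hp.1 hq.1 hp.2.1 hq.2.1).trans ?_
      refine le_trans (le_of_eq ?_) (hD _ (lipneg q hq))
      exact Finset.sum_congr rfl fun y _ => by ring
    · exact (Hent_gibbs hq.1 hp.1 hq.2.1 hp.2.1).trans (hD _ hp.log_lip)
  obtain ⟨o1, o2⟩ := gib _ _ (gout pA hpA) (gout pA' hpA') _ dualout
  have hx := fun x => gib _ _ (gcond pA hpA x) (gcond pA' hpA' x) _ (fun f hf => dual f hf x)
  have c1 : ∑ x, pX x * Hent (condOut W pA x) - ∑ x, pX x * Hent (condOut W pA' x)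
      ≤ c * n * S := by
    rw [eS, ← Finset.sum_sub_distrib]
    refine Finset.sum_le_sum fun x _ => ?_
    rw [← mul_sub]
    exact mul_le_mul_of_nonneg_left (hx x).1 (hpX.1 x)
  have c2 : ∑ x, pX x * Hent (condOut W pA' x) - ∑ x, pX x * Hent (condOut W pA x)
      ≤ c * n * S := by
    rw [eS, ← Finset.sum_sub_distrib]
    refine Finset.sum_le_sum fun x _ => ?_
    rw [← mul_sub]
    exact mul_le_mul_of_nonneg_left (hx x).2 (hpX.1 x)
  have e2 : 2 * c * n * S = c * n * S + c * n * S := by ring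
  rw [e2, abs_le]
  constructor <;> linarith
end
end

section
/- Let 𝒳 and 𝒴 be finite alphabets and n ≥ 1. Let P_{XY} and Q_{XY} be joint distributions on 𝒳ⁿ × 𝒴ⁿ whose conditional laws coincide and are memoryless: P_{Y|X} = Q_{Y|X} = ∏_{i=1}^n P_{Y_i|X_i} for given stochastic matrices P_{Y_i|X_i} from 𝒳 to 𝒴. Then d̄(P_Y, Q_Y) ≤ ( max_{i∈{1,…,n}} η_TV(P_{Y_i|X_i}) ) · d̄(P_X, Q_X), where for a stochastic matrix K the Dobrushin coefficient is η_TV(K) = max_{x,x'} d_TV( K(·|x), K(·|x') ). -/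
open scoped BigOperators

noncomputable section

/-- Total variation distance between distributions on a finite set. -/
def dTV {α : Type*} [Fintype α] (p q : α → ℝ) : ℝ :=
  (1 / 2) * ∑ a, |p a - q a|

theorem aux_sum_prod {α : Type*} [Fintype α] {n : ℕ} (f : Fin n → α → ℝ) :
    ∑ y : Fin n → α, ∏ i, f i (y i) = ∏ i, ∑ a, f i a := by
  rw [Finset.prod_univ_sum, Fintype.piFinset_univ]

theorem aux_sum_prod2 {α : Type*} [Fintype α] {n : ℕ} (f : Fin n → α → α → ℝ) :
    ∑ y : Fin n → α, ∑ y' : Fin n → α, ∏ i, f i (y i) (y' i) = ∏ i, ∑ a, ∑ b, f i a b := by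
  rw [← aux_sum_prod]
  exact Finset.sum_congr rfl fun y _ => aux_sum_prod (fun i b => f i (y i) b)

theorem aux_coupling {α : Type*} [Fintype α] [DecidableEq α] (p q : α → ℝ)
    (hp : ∀ a, 0 ≤ p a) (hq : ∀ a, 0 ≤ q a) (hp1 : ∑ a, p a = 1) (hq1 : ∑ a, q a = 1) :
    ∃ g : α → α → ℝ, (∀ a b, 0 ≤ g a b) ∧ (∀ a, ∑ b, g a b = p a) ∧ (∀ b, ∑ a, g a b = q b) ∧
      ∑ a, ∑ b, g a b * (if a ≠ b then 1 else 0) ≤ dTV p q := by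
  set u : α → ℝ := fun a => p a - min (p a) (q a) with hu
  set v : α → ℝ := fun a => q a - min (p a) (q a) with hv
  set t : ℝ := dTV p q with ht
  have hu0 : ∀ a, 0 ≤ u a := fun a => sub_nonneg.2 (min_le_left _ _)
  have hv0 : ∀ a, 0 ≤ v a := fun a => sub_nonneg.2 (min_le_right _ _)
  have huv : ∑ a, u a = ∑ a, v a := by
    simp only [hu, hv, Finset.sum_sub_distrib, hp1, hq1]
  have huv2 : ∑ a, u a + ∑ a, v a = 2 * t := by
    rw [← Finset.sum_add_distrib, ht, dTV, ← mul_assoc]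
    norm_num
    refine Finset.sum_congr rfl fun a _ => ?_
    simp only [hu, hv]
    rcases le_total (p a) (q a) with h | h
    · rw [min_eq_left h, abs_of_nonpos (by linarith)]; ring
    · rw [min_eq_right h, abs_of_nonneg (by linarith)]; ring
  have hut : ∑ a, u a = t := by linarith
  have hvt : ∑ a, v a = t := by linarith
  have ht0 : 0 ≤ t := hut ▸ Finset.sum_nonneg fun a _ => hu0 a
  have hdu : ∀ a, u a * t / t = u a := by
    intro a
    rcases eq_or_ne t 0 with h | h
    · have := (Finset.sum_eq_zero_iff_of_nonneg fun a _ => hu0 a).1 (hut.trans h) a (Finset.mem_univ a)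
      simp [this]
    · field_simp
  have hdv : ∀ a, t * v a / t = v a := by
    intro a
    rcases eq_or_ne t 0 with h | h
    · have := (Finset.sum_eq_zero_iff_of_nonneg fun a _ => hv0 a).1 (hvt.trans h) a (Finset.mem_univ a)
      simp [this]
    · field_simp
  refine ⟨fun a b => (if a = b then min (p a) (q a) else 0) + u a * v b / t, ?_, ?_, ?_, ?_⟩
  · intro a b
    have := div_nonneg (mul_nonneg (hu0 a) (hv0 b)) ht0
    have := le_min (hp a) (hq a)
    dsimp only
    split_ifs <;> linarith
  · intro a
    rw [Finset.sum_add_distrib, ← Finset.sum_div, ← Finset.mul_sum, hvt, hdu]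
    simp [hu]
  · intro b
    rw [Finset.sum_add_distrib, ← Finset.sum_div, ← Finset.sum_mul, hut, hdv]
    simp [hv]
  · calc _ ≤ ∑ a, ∑ b, u a * v b / t := by
          refine Finset.sum_le_sum fun a _ => Finset.sum_le_sum fun b _ => ?_
          have := div_nonneg (mul_nonneg (hu0 a) (hv0 b)) ht0
          by_cases h : a = b
          · simpa [h] using h ▸ this
          · simp [h]
      _ = ∑ a, u a := by
          refine Finset.sum_congr rfl fun a _ => ?_
          rw [← Finset.sum_div, ← Finset.mul_sum, hvt, hdu]
      _ ≤ t := hut.le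

theorem aux_cost {α : Type*} [Fintype α] [DecidableEq α] {n : ℕ} (g : Fin n → α → α → ℝ)
    (hg : ∀ i, ∑ a, ∑ b, g i a b = 1) :
    ∑ y : Fin n → α, ∑ y' : Fin n → α, (∏ i, g i (y i) (y' i)) * (hammingDist y y' : ℝ)
      = ∑ i, ∑ a, ∑ b, g i a b * (if a ≠ b then 1 else 0) := by
  have h1 : ∀ y y' : Fin n → α, (∏ i, g i (y i) (y' i)) * (hammingDist y y' : ℝ)
      = ∑ i, ∏ j, (g j (y j) (y' j) * if j = i then (if y j ≠ y' j then 1 else 0) else 1) := by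
    intro y y'
    have : (hammingDist y y' : ℝ) = ∑ i, if y i ≠ y' i then (1 : ℝ) else 0 := by
      rw [Finset.sum_boole]; rfl
    rw [this, Finset.mul_sum]
    refine Finset.sum_congr rfl fun i _ => ?_
    rw [Finset.prod_mul_distrib, Finset.prod_ite_eq' Finset.univ i]
    simp
  simp_rw [h1]
  have h2 : ∀ y : Fin n → α, ∑ y' : Fin n → α, ∑ i, ∏ j, (g j (y j) (y' j) *
      if j = i then (if y j ≠ y' j then (1:ℝ) else 0) else 1) = ∑ i, ∑ y' : Fin n → α, ∏ j, (g j (y j) (y' j) *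
      if j = i then (if y j ≠ y' j then (1:ℝ) else 0) else 1) := fun y => Finset.sum_comm
  simp_rw [h2]
  rw [Finset.sum_comm]
  refine Finset.sum_congr rfl fun i _ => ?_
  rw [aux_sum_prod2 (fun j a b => g j a b * if j = i then (if a ≠ b then (1:ℝ) else 0) else 1)]
  rw [Finset.prod_eq_single i]
  · simp
  · intro j _ hj
    simpa [hj] using hg j
  · simp

/-- (Contraction) Let `P_{XY}` and `Q_{XY}` be joint distributions on
`𝒳ⁿ × 𝒴ⁿ` with the same memoryless conditional law `∏ᵢ P_{Yᵢ|Xᵢ}` given by stochastic matrices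
`K i`; equivalently, `P_Y(y) = ∑_x P_X(x) ∏ᵢ K i (xᵢ) (yᵢ)` and similarly for `Q`. Then
`d̄(P_Y, Q_Y) ≤ (maxᵢ η_TV(K i)) · d̄(P_X, Q_X)`, where
`η_TV(K) = max_{x,x'} d_TV(K(·|x), K(·|x'))` is Dobrushin's coefficient. -/
theorem stmt18 {𝒳 𝒴 : Type*} [Fintype 𝒳] [Fintype 𝒴] [DecidableEq 𝒳] [DecidableEq 𝒴]
    [Nonempty 𝒳] {n : ℕ} (hn : 1 ≤ n)
    (pX qX : (Fin n → 𝒳) → ℝ) (hpX : IsDist pX) (hqX : IsDist qX)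
    (K : Fin n → 𝒳 → 𝒴 → ℝ)
    (hK : ∀ i x, (∀ y, 0 ≤ K i x y) ∧ ∑ y, K i x y = 1) :
    dbar n (fun y => ∑ x, pX x * ∏ i, K i (x i) (y i))
        (fun y => ∑ x, qX x * ∏ i, K i (x i) (y i)) ≤
      (⨆ i : Fin n, ⨆ x : 𝒳, ⨆ x' : 𝒳, dTV (K i x) (K i x')) * dbar n pX qX := by
  set η : ℝ := ⨆ i : Fin n, ⨆ x : 𝒳, ⨆ x' : 𝒳, dTV (K i x) (K i x') with hη
  have hle : ∀ i x x', dTV (K i x) (K i x') ≤ η := by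
    intro i x x'
    refine le_trans ?_ (le_ciSup (f := fun i => ⨆ x : 𝒳, ⨆ x' : 𝒳, dTV (K i x) (K i x'))
      (Set.finite_range _).bddAbove i)
    refine le_trans ?_ (le_ciSup (f := fun x => ⨆ x' : 𝒳, dTV (K i x) (K i x'))
      (Set.finite_range _).bddAbove x)
    exact le_ciSup (f := fun x' => dTV (K i x) (K i x')) (Set.finite_range _).bddAbove x'
  have hdiag : ∀ i x, dTV (K i x) (K i x) = 0 := by intro i x; simp [dTV]
  have hη0 : 0 ≤ η := by
    have x : 𝒳 := Classical.arbitrary _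
    rw [← hdiag ⟨0, hn⟩ x]
    exact hle _ _ _
  have hle2 : ∀ i x x', dTV (K i x) (K i x') ≤ η * (if x ≠ x' then 1 else 0) := by
    intro i x x'
    by_cases h : x = x'
    · subst h; simp [hdiag]
    · simpa [h] using hle i x x'
  choose g hg0 hg1 hg2 hg3 using fun i x x' =>
    aux_coupling (K i x) (K i x') (hK i x).1 (hK i x').1 (hK i x).2 (hK i x').2
  have hcost : ∀ x x' : Fin n → 𝒳, ∑ y : Fin n → 𝒴, ∑ y' : Fin n → 𝒴,
      (∏ i, g i (x i) (x' i) (y i) (y' i)) * (hammingDist y y' : ℝ) ≤ η * hammingDist x x' := by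
    intro x x'
    rw [aux_cost (fun i => g i (x i) (x' i))
      (fun i => by simp_rw [hg1]; exact (hK i (x i)).2)]
    have : (hammingDist x x' : ℝ) = ∑ i, if x i ≠ x' i then (1 : ℝ) else 0 := by
      rw [Finset.sum_boole]; rfl
    rw [this, Finset.mul_sum]
    exact Finset.sum_le_sum fun i _ => (hg3 i _ _).trans (hle2 i _ _)
  conv_rhs => rw [dbar, ← smul_eq_mul, ← Real.sInf_smul_of_nonneg hη0]
  refine le_csInf ?_ ?_
  · refine Set.Nonempty.smul_set ⟨_, fun z => pX z.1 * qX z.2, ?_, ?_, ?_, rfl⟩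
    · exact fun z => mul_nonneg (hpX.1 _) (hqX.1 _)
    · intro x; simp [← Finset.mul_sum, hqX.2]
    · intro x; simp [← Finset.sum_mul, hpX.2]
  rintro _ ⟨r, ⟨γ, h0, h1, h2, rfl⟩, rfl⟩
  have hbdd : BddBelow { r | ∃ γ : (Fin n → 𝒴) × (Fin n → 𝒴) → ℝ,
    (∀ z, 0 ≤ γ z) ∧ (∀ y, ∑ y', γ (y, y') = ∑ x, pX x * ∏ i, K i (x i) (y i)) ∧
    (∀ y', ∑ y, γ (y, y') = ∑ x, qX x * ∏ i, K i (x i) (y' i)) ∧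
    r = (1 / (n : ℝ)) * ∑ z : (Fin n → 𝒴) × (Fin n → 𝒴), γ z * (hammingDist z.1 z.2 : ℝ) } := by
    refine ⟨0, ?_⟩
    rintro _ ⟨γ, h0, -, -, rfl⟩
    exact mul_nonneg (by positivity)
      (Finset.sum_nonneg fun z _ => mul_nonneg (h0 z) (by positivity))
  refine (csInf_le hbdd ⟨fun w => ∑ z, γ z * ∏ i, g i (z.1 i) (z.2 i) (w.1 i) (w.2 i),
    ?_, ?_, ?_, rfl⟩).trans ?_
  · exact fun w => Finset.sum_nonneg fun z _ => mul_nonneg (h0 z)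
      (Finset.prod_nonneg fun i _ => hg0 _ _ _ _ _)
  · intro y
    rw [Finset.sum_comm]
    simp_rw [← Finset.mul_sum]
    rw [Fintype.sum_prod_type]
    refine Finset.sum_congr rfl fun x _ => ?_
    rw [← h1 x, Finset.sum_mul]
    refine Finset.sum_congr rfl fun x' _ => ?_
    rw [aux_sum_prod (fun i b => g i (x i) (x' i) (y i) b)]
    simp_rw [hg1]
  · intro y
    rw [Finset.sum_comm]
    simp_rw [← Finset.mul_sum]
    rw [Fintype.sum_prod_type, Finset.sum_comm]
    refine Finset.sum_congr rfl fun x' _ => ?_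
    rw [← h2 x', Finset.sum_mul]
    refine Finset.sum_congr rfl fun x _ => ?_
    rw [aux_sum_prod (fun i a => g i (x i) (x' i) a (y i))]
    simp_rw [hg2]
  · simp only [smul_eq_mul]
    rw [mul_left_comm]
    refine mul_le_mul_of_nonneg_left ?_ (by positivity)
    simp_rw [Finset.sum_mul]
    rw [Finset.sum_comm, Finset.mul_sum]
    refine Finset.sum_le_sum fun z _ => ?_
    simp_rw [mul_assoc]
    rw [← Finset.mul_sum, mul_left_comm η]
    refine mul_le_mul_of_nonneg_left ?_ (h0 z)
    rw [Fintype.sum_prod_type]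
    exact hcost z.1 z.2
end
end
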